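/- There do not exist positive integers k, m, M, r with r ≥ 2, k ≤ 49, M > m > 1, r not a perfect square, such that (r−1)·m² + M² − m + 2 − k² ≤ 0 and k/((r−1)·m + M) < 1/(√r + δ(r)), with δ(2)=0.031, δ(3)=0.018, δ(5)=0.014, δ(6)=0.022, δ(7)=0.011, δ(8)=0.012, δ(r)=0.013 otherwise. -/

import Mathlib

/-- The constant δ(r) from Theorem 3.1. -/
noncomputable def delta (r : ℕ) : ℝ :=
  if r = 2 then 0.031 else if r = 3 then 0.018 else if r = 5 then 0.014
  else if r = 6 then 0.022 else if r = 7 then 0.011 else if r = 8 then 0.012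
  else 0.013

/-- The numerator of `delta r` over the denominator `1000`. -/
def deltaMilli (r : ℕ) : ℕ :=
  if r = 2 then 31 else if r = 3 then 18 else if r = 5 then 14
  else if r = 6 then 22 else if r = 7 then 11 else if r = 8 then 12
  else 13

lemma delta_eq_deltaMilli_div (r : ℕ) : delta r = (deltaMilli r : ℝ) / 1000 := by
  unfold delta deltaMilli
  split_ifs <;> norm_num

set_option maxRecDepth 100000 in
set_option synthInstance.maxHeartbeats 400000 in
set_option synthInstance.maxSize 2000 in
/-- The finite search for a fixed `r` and `m`, with `d = M - m`. -/
def SearchAt (r m : ℕ) : Prop :=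
  ∀ d < 8, 1 ≤ d → (r - 1) * d ^ 2 < r * (m - 2) →
    ∀ k < 50, r * m ^ 2 + 2 * m * d + d ^ 2 + 2 ≤ k ^ 2 + m →
      (1000 * (r * m + d) - deltaMilli r * k) ^ 2 ≤ 1000000 * (k ^ 2 * r)

instance (r m : ℕ) : Decidable (SearchAt r m) := by
  unfold SearchAt
  infer_instance

set_option maxRecDepth 100000 in
lemma searchAt_of_mul_sq_le :
    ∀ r < 601, 2 ≤ r → ∀ m < 35, 2 ≤ m → r * m ^ 2 ≤ 2401 → SearchAt r m := by
  decide +kernel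

/-- The irrational inequality, squared and cleared of denominators. -/
lemma sq_lt_of_div_lt {k s r : ℕ} (hs : 0 < s)
    (h : (k : ℝ) / s < 1 / (Real.sqrt r + delta r)) (hr : 0 < r) :
    1000000 * (k ^ 2 * r) < (1000 * s - deltaMilli r * k) ^ 2 ∧ k ^ 2 * r < s ^ 2 := by
  rw [delta_eq_deltaMilli_div] at h
  set D := deltaMilli r
  have hsqrt : 0 < Real.sqrt r := Real.sqrt_pos.mpr (by exact_mod_cast hr)
  have hsq : Real.sqrt r ^ 2 = r := Real.sq_sqrt (Nat.cast_nonneg r)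
  have hD : (0 : ℝ) ≤ D := Nat.cast_nonneg D
  have hk : (0 : ℝ) ≤ k := Nat.cast_nonneg k
  have hs' : (0 : ℝ) < s := by exact_mod_cast hs
  rw [div_lt_div_iff₀ hs' (by positivity)] at h
  have hDk : 0 ≤ (D : ℝ) * k := by positivity
  have hksqrt : 0 ≤ k * Real.sqrt r := by positivity
  have hlt : 1000 * (k * Real.sqrt r) < 1000 * s - D * k := by linarith
  have hle : D * k ≤ 1000 * s := by
    have : (D : ℝ) * k ≤ 1000 * s := by linarith
    exact_mod_cast this
  constructor
  · have h2 := pow_lt_pow_left₀ hlt (by positivity) two_ne_zero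
    have h3 : (1000000 : ℝ) * (k ^ 2 * r) < (1000 * s - D * k) ^ 2 := by
      rw [← hsq]; linarith
    zify [hle]
    exact_mod_cast h3
  · have h2 := pow_lt_pow_left₀ (show k * Real.sqrt r < s by linarith) hksqrt two_ne_zero
    rw [mul_pow, hsq] at h2
    exact_mod_cast h2

theorem stmt_4 :
    ¬ ∃ (k m M r : ℕ), 0 < k ∧ 0 < m ∧ 0 < M ∧ 0 < r ∧ 2 ≤ r ∧ k ≤ 49 ∧
      1 < m ∧ m < M ∧ ¬ IsSquare r ∧
      ((r : ℤ) - 1) * m ^ 2 + M ^ 2 - m + 2 - k ^ 2 ≤ 0 ∧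
      (k : ℝ) / ((r - 1) * m + M) < 1 / (Real.sqrt r + delta r) := by
  rintro ⟨k, m, M, r, -, -, -, hr0, hr, hk, hm, hmM, -, hC, hlt⟩
  obtain ⟨d, rfl⟩ := Nat.exists_eq_add_of_le hmM.le
  have hd : 1 ≤ d := by omega
  have hS : ((r : ℝ) - 1) * m + ((m + d : ℕ) : ℝ) = ((r * m + d : ℕ) : ℝ) := by
    push_cast; ring
  rw [hS] at hlt
  obtain ⟨hsq, hcauchy⟩ := sq_lt_of_div_lt (by omega) hlt hr0
  have hC' : r * m ^ 2 + 2 * m * d + d ^ 2 + 2 ≤ k ^ 2 + m := by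
    zify
    push_cast at hC
    linarith
  have hk2 : k ^ 2 ≤ 2401 := Nat.pow_le_pow_left hk 2
  have hrm : r * m ^ 2 ≤ 2401 := by nlinarith
  have hm35 : m < 35 := by
    by_contra! h
    nlinarith [Nat.mul_le_mul hr (Nat.pow_le_pow_left h 2)]
  have hr601 : r < 601 := by
    nlinarith [Nat.mul_le_mul_left r (Nat.pow_le_pow_left (show 2 ≤ m from hm) 2)]
  obtain ⟨q, rfl⟩ := Nat.exists_eq_add_of_le' hr0
  obtain ⟨n, rfl⟩ := Nat.exists_eq_add_of_le' (show 2 ≤ m from hm)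
  have hspread : q * d ^ 2 < (q + 1) * n := by
    have := Nat.mul_le_mul_left (q + 1) hC'
    zify at this hcauchy ⊢
    linarith
  have hd8 : d < 8 := by
    by_contra! h
    have := Nat.mul_le_mul_left q (Nat.pow_le_pow_left h 2)
    nlinarith
  exact absurd hsq (not_lt.mpr (searchAt_of_mul_sq_le _ hr601 hr _ hm35 hm hrm d hd8 hd
    (by simpa using hspread) k (by omega) hC'))
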